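/- Let φ : R → S be a homomorphism of rings (not necessarily commutative). Then for all left S-modules M, M' and all i ≥ 0 the natural map Ext^i_S(M, M') → Ext^i_R(M, M') induced by restriction of scalars is an isomorphism if and only if the functor D(φ) : D(S) → D(R) between unbounded derived categories induced by restriction of scalars is fully faithful. -/

import Mathlib

/-!
Homological epimorphisms of rings (Geigle–Lenzing).
`φ : R →+* S`; every `S`-module is an `R`-module by restriction of scalars.
-/

universe w u

open CategoryTheory Limits DerivedCategory

noncomputable section

namespace RingHomEpi

variable {R S : Type u} [Ring R] [Ring S] (φ : R →+* S)

instance : (ModuleCat.restrictScalars.{u} φ).Additive where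
  map_add := rfl

/-- `S` regarded as an `R`-module via `φ`. -/
abbrev SasR : ModuleCat.{u} R := (ModuleCat.restrictScalars φ).obj (ModuleCat.of S S)

/-- The canonical map `η_M : M → Hom_R(S, M)`, `m ↦ (s ↦ s • m)`. -/
def etaMap (M : ModuleCat.{u} S) :
    M → (SasR φ →ₗ[R] (ModuleCat.restrictScalars φ).obj M) := fun m =>
  { toFun := fun s => (show S from s) • (show M from m)
    map_add' := fun s t => add_smul (show S from s) (show S from t) (show M from m)
    map_smul' := fun r s => by
      show (φ r • (show S from s)) • (show M from m) =
        φ r • ((show S from s) • (show M from m))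
      exact smul_assoc (φ r) (show S from s) (show M from m) }

/-- Restriction of scalars is compatible with the forgetful functors to abelian groups. -/
def restrictScalarsCompForget₂Iso :
    ModuleCat.restrictScalars.{u} φ ⋙ forget₂ (ModuleCat.{u} R) AddCommGrpCat ≅
      forget₂ (ModuleCat.{u} S) AddCommGrpCat :=
  NatIso.ofComponents (fun _ => Iso.refl _) (fun _ => rfl)

instance : PreservesFiniteLimits (ModuleCat.restrictScalars.{u} φ) := by
  have : PreservesFiniteLimits
      (ModuleCat.restrictScalars.{u} φ ⋙ forget₂ (ModuleCat.{u} R) AddCommGrpCat) :=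
    preservesFiniteLimits_of_natIso (restrictScalarsCompForget₂Iso φ).symm
  exact preservesFiniteLimits_of_reflects_of_preserves _
    (forget₂ (ModuleCat.{u} R) AddCommGrpCat)

instance : PreservesFiniteColimits (ModuleCat.restrictScalars.{u} φ) := by
  have : PreservesFiniteColimits
      (ModuleCat.restrictScalars.{u} φ ⋙ forget₂ (ModuleCat.{u} R) AddCommGrpCat) :=
    preservesFiniteColimits_of_natIso (restrictScalarsCompForget₂Iso φ).symm
  exact preservesFiniteColimits_of_reflects_of_preserves _
    (forget₂ (ModuleCat.{u} R) AddCommGrpCat)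

attribute [local instance] CategoryTheory.hasExt_of_hasDerivedCategory

variable [HasDerivedCategory.{w} (ModuleCat.{u} R)]
  [HasDerivedCategory.{w} (ModuleCat.{u} S)]

/-- The functor `D(φ) : D(S) → D(R)` induced by restriction of scalars along `φ`. -/
abbrev Dphi : DerivedCategory (ModuleCat.{u} S) ⥤ DerivedCategory (ModuleCat.{u} R) :=
  (ModuleCat.restrictScalars.{u} φ).mapDerivedCategory

/-- `D(φ)` commutes with the single complex functors. -/
def singleObjIso (M : ModuleCat.{u} S) :
    (Dphi φ).obj ((DerivedCategory.singleFunctor (ModuleCat.{u} S) 0).obj M) ≅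
      (DerivedCategory.singleFunctor (ModuleCat.{u} R) 0).obj
        ((ModuleCat.restrictScalars φ).obj M) :=
  (Dphi φ).mapIso
    (((SingleFunctors.evaluation _ _ 0).mapIso
      (DerivedCategory.singleFunctorsPostcompQIso (ModuleCat.{u} S))).app M)
  ≪≫ ((ModuleCat.restrictScalars.{u} φ).mapDerivedCategoryFactors.app _)
  ≪≫ DerivedCategory.Q.mapIso
      ((HomologicalComplex.singleMapHomologicalComplex
        (ModuleCat.restrictScalars.{u} φ) (ComplexShape.up ℤ) 0).app M)
  ≪≫ (((SingleFunctors.evaluation _ _ 0).mapIso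
      (DerivedCategory.singleFunctorsPostcompQIso (ModuleCat.{u} R))).symm.app _)

/-- The natural comparison map `Ext^n_S(M, M') → Ext^n_R(M, M')` induced by
restriction of scalars along `φ`. -/
def extMap {M M' : ModuleCat.{u} S} {n : ℕ} (e : Abelian.Ext.{w} M M' n) :
    Abelian.Ext.{w} ((ModuleCat.restrictScalars φ).obj M)
      ((ModuleCat.restrictScalars φ).obj M') n :=
  Abelian.Ext.homEquiv.symm
    ((singleObjIso φ M).inv ≫ (Dphi φ).map e.hom ≫
      ((Dphi φ).commShiftIso (n : ℤ)).hom.app _ ≫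
      (shiftFunctor (DerivedCategory (ModuleCat.{u} R)) (n : ℤ)).map
        (singleObjIso φ M').hom)



section KProj

universe v₁ u₁

variable {C : Type u₁} [Category.{v₁} C] [Abelian C] (G : C)

open HomologicalComplex ZeroObject

/-- The inclusion of the sphere in the disk. -/
def sphereDisk (n : ℤ) : (single C (ComplexShape.up ℤ) n).obj G ⟶
    double (c := ComplexShape.up ℤ) (i₀ := n - 1) (i₁ := n) (𝟙 G) (by simp) :=
  mkHomFromSingle (doubleXIso₁ (𝟙 G) _ (by lia)).inv (by
    intro k hk
    rw [double_d_eq_zero₀ _ _ _ _ (by lia), comp_zero])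

lemma sphereDisk_f (n : ℤ) : (sphereDisk G n).f n =
    (singleObjXSelf (ComplexShape.up ℤ) n G).hom ≫ (doubleXIso₁ (𝟙 G) _ (by lia)).inv := by
  simp [sphereDisk]

instance (n : ℤ) : Mono (sphereDisk G n) := by
  refine HomologicalComplex.mono_of_mono_f _ (fun i => ?_)
  by_cases hi : i = n
  · subst hi
    rw [sphereDisk_f]
    infer_instance
  · exact (isZero_single_obj_X (ComplexShape.up ℤ) n G i hi).mono _

/-- The generating cofibrations. -/
def genCof : MorphismProperty (CochainComplex C ℤ) :=
  MorphismProperty.ofHoms (fun n : ℤ => sphereDisk G n)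

lemma genCof_rlp_of {K L : CochainComplex C ℤ} (p : K ⟶ L)
    (hp : ∀ (n m : ℤ) (_ : m + 1 = n) (z : G ⟶ K.X n) (y : G ⟶ L.X m),
      (∀ k, z ≫ K.d n k = 0) → y ≫ L.d m n = z ≫ p.f n →
      ∃ x : G ⟶ K.X m, x ≫ K.d m n = z ∧ x ≫ p.f m = y) :
    (genCof G).rlp p := by
  rintro _ _ _ ⟨n⟩
  refine ⟨fun {t b} sq => ?_⟩
  obtain ⟨x, hx, hx'⟩ := hp n (n - 1) (by lia)
    ((singleObjXSelf (ComplexShape.up ℤ) n G).inv ≫ t.f n)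
    ((doubleXIso₀ _ _).inv ≫ b.f (n-1)) (by simp) (by
      have := HomologicalComplex.congr_hom sq.w n
      simp only [comp_f, sphereDisk_f] at this
      simp [this, double_d _ _ (show n - 1 ≠ n by lia)])
  refine ⟨⟨⟨mkHomFromDouble _ (by lia) x (x ≫ K.d (n-1) n) (by simp) (by simp), ?_, ?_⟩⟩⟩
  · apply from_single_hom_ext
    simp [sphereDisk_f, hx]
  · apply from_double_hom_ext
    · simp [hx']
    · have := HomologicalComplex.congr_hom sq.w n
      simp only [comp_f, sphereDisk_f] at this
      simp [hx, this]

lemma genCof_rlp_exists {X Y : CochainComplex C ℤ} (p : X ⟶ Y) (hp : (genCof G).rlp p)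
    (n m : ℤ) (h : m + 1 = n) (z : G ⟶ X.X n) (y : G ⟶ Y.X m)
    (hz : ∀ k, z ≫ X.d n k = 0) (hy : y ≫ Y.d m n = z ≫ p.f n) :
    ∃ x : G ⟶ X.X m, x ≫ X.d m n = z ∧ x ≫ p.f m = y := by
  obtain rfl : m = n - 1 := by lia
  have := hp _ ⟨n⟩
  have sq : CommSq (mkHomFromSingle z (fun k _ => hz k)) (sphereDisk G n) p
      (mkHomFromDouble _ (by lia) y (y ≫ Y.d (n-1) n) (by simp) (by simp)) := ⟨by
    apply from_single_hom_ext
    simp [sphereDisk_f, hy]⟩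
  obtain ⟨l, hl1, hl2⟩ : ∃ l, sphereDisk G n ≫ l = (mkHomFromSingle z (fun k _ => hz k)) ∧
      l ≫ p = mkHomFromDouble _ (by lia) y (y ≫ Y.d (n-1) n) (by simp) (by simp) :=
    ⟨sq.lift, sq.fac_left, sq.fac_right⟩
  have h1 := HomologicalComplex.congr_hom hl1 n
  have h2 := HomologicalComplex.congr_hom hl2 (n - 1)
  have h3 := l.comm (n - 1) n
  refine ⟨(doubleXIso₀ _ _).inv ≫ l.f (n-1), ?_, ?_⟩
  · simp [sphereDisk_f] at h1
    rw [double_d _ _ (by lia)] at h3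
    simp [h3, h1]
  · simp at h2
    simp [h2]

variable {G}

lemma quasiIso_of_genCof_rlp [Projective G] (hG : IsSeparator G)
    {X Y : CochainComplex C ℤ} (p : X ⟶ Y) (hp : (genCof G).rlp p) : QuasiIso p := by
  rw [Preadditive.isSeparator_iff] at hG
  rw [quasiIso_iff]
  intro n
  rw [quasiIsoAt_iff_isIso_homologyMap]
  have : Mono (homologyMap p n) := by
    rw [Preadditive.mono_iff_cancel_zero]
    intro A g hg
    apply hG
    intro h
    let z : G ⟶ X.cycles n := Projective.factorThru (h ≫ g) (X.homologyπ n)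
    have hz : z ≫ X.homologyπ n = h ≫ g := Projective.factorThru_comp _ _
    have h0 : (z ≫ cyclesMap p n) ≫ Y.homologyπ n = 0 := by
      rw [Category.assoc, ← homologyπ_naturality, ← Category.assoc, hz, Category.assoc, hg,
        comp_zero]
    have ex : (ShortComplex.mk (Y.toCycles (n-1) n) (Y.homologyπ n) (by simp)).Exact :=
      ShortComplex.exact_of_g_is_cokernel _ (Y.homologyIsCokernel (n-1) n (by simp))
    let y : G ⟶ Y.X (n-1) := ex.liftFromProjective (z ≫ cyclesMap p n) h0
    have hy : y ≫ Y.toCycles (n-1) n = z ≫ cyclesMap p n := ex.liftFromProjective_comp _ h0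
    obtain ⟨x, hx, -⟩ := genCof_rlp_exists G p hp n (n-1) (by lia) (z ≫ X.iCycles n) y
      (by simp) (by
        rw [← toCycles_i, ← Category.assoc, hy]; simp)
    have : x ≫ X.toCycles (n-1) n = z := by
      rw [← cancel_mono (X.iCycles n)]; simpa using hx
    rw [← hz, ← this]; simp
  have : Epi (homologyMap p n) := by
    rw [Preadditive.epi_iff_cancel_zero]
    intro A g hg
    apply hG
    intro h
    let z : G ⟶ Y.cycles n := Projective.factorThru h (Y.homologyπ n)
    have hz : z ≫ Y.homologyπ n = h := Projective.factorThru_comp _ _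
    obtain ⟨x, hx, hx'⟩ := genCof_rlp_exists G p hp (n+1) n (by lia) 0 (z ≫ Y.iCycles n)
      (by simp) (by simp)
    have : X.liftCycles x (n+1) (by simp) hx ≫ cyclesMap p n = z := by
      rw [← cancel_mono (Y.iCycles n)]; simpa using hx'
    rw [← hz, ← this]
    simp only [Category.assoc]
    rw [← homologyπ_naturality_assoc, hg]
    simp
  exact isIso_of_mono_of_epi _

lemma exists_lift_of_acyclic [Projective G] {L : CochainComplex C ℤ} (hL : L.Acyclic)
    (n m : ℤ) (h : m + 1 = n) (z : G ⟶ L.X n) (hz : z ≫ L.d n (n+1) = 0) :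
    ∃ x : G ⟶ L.X m, x ≫ L.d m n = z := by
  have h := (exactAt_iff' _ m n (n+1) (by simp; lia) (by simp)).1 (hL n)
  exact ⟨h.liftFromProjective z hz, h.liftFromProjective_comp z hz⟩

lemma isKProjective_of_genCof [Projective G] (P : CochainComplex C ℤ)
    (hP : (genCof G).rlp.llp (0 : 0 ⟶ P)) : P.IsKProjective := by
  refine ⟨fun {L} f hL => ?_⟩
  let E := CochainComplex.mappingCocone (𝟙 L)
  let π : E ⟶ L := CochainComplex.mappingCocone.fst (𝟙 L)
  have hE : IsZero ((HomotopyCategory.quotient C (ComplexShape.up ℤ)).obj E) := by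
    have h0 : IsZero ((HomotopyCategory.quotient C (ComplexShape.up ℤ)).obj
        (CochainComplex.mappingCone (𝟙 L))) :=
      (HomotopyCategory.isZero_quotient_obj_iff _).2
        ⟨CochainComplex.mappingCone.homotopyToZeroOfId L⟩
    exact ((shiftFunctor (HomotopyCategory C (ComplexShape.up ℤ)) (-1 : ℤ)).map_isZero h0).of_iso
      (((HomotopyCategory.quotient C (ComplexShape.up ℤ)).commShiftIso (-1 : ℤ)).app
        (CochainComplex.mappingCone (𝟙 L)))
  have hE' : E.Acyclic := by
    rw [← HomotopyCategory.quotient_obj_mem_subcategoryAcyclic_iff_acyclic]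
    rw [HomotopyCategory.mem_subcategoryAcyclic_iff]
    intro n
    exact (HomotopyCategory.homologyFunctor C _ n).map_isZero hE
  have hπ : (genCof G).rlp π := by
    apply genCof_rlp_of
    intro n m h z y hz hy
    obtain ⟨x₀, hx₀⟩ := exists_lift_of_acyclic hE' n m h z (hz _)
    obtain ⟨l, hl⟩ := exists_lift_of_acyclic hL m (m-1) (by lia) (x₀ ≫ π.f m - y) (by
      subst h
      simp [hy, reassoc_of% hx₀])
    refine ⟨x₀ - l ≫ (CochainComplex.mappingCocone.inl (𝟙 L)).v _ _ (add_zero _) ≫ E.d (m-1) m,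
      ?_, ?_⟩
    · simp [hx₀]
    · have := CochainComplex.mappingCocone.inl_v_fst_f (𝟙 L) (m - 1)
      simp only [Preadditive.sub_comp, Category.assoc, ← π.comm]
      rw [reassoc_of% this, hl]
      simp
  have := hP _ hπ
  have sq : CommSq (0 : 0 ⟶ E) (0 : 0 ⟶ P) π f := ⟨by simp⟩
  refine ⟨HomotopyCategory.homotopyOfEq _ _ ?_⟩
  rw [← sq.fac_right, Functor.map_comp, hE.eq_of_tgt ((HomotopyCategory.quotient C _).map sq.lift) 0]
  simp

lemma genCof_le_mono : genCof G ≤ MorphismProperty.monomorphisms _ := by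
  rintro _ _ _ ⟨n⟩
  exact inferInstanceAs (Mono (sphereDisk G n))

open MorphismProperty in
lemma hasSmallObjectArgument_genCof [IsGrothendieckAbelian.{w} C] :
    MorphismProperty.HasSmallObjectArgument.{w} (genCof G) := by
  obtain ⟨κ, hκ', hκ⟩ := HasCardinalLT.exists_regular_cardinal.{w}
    (Σ n : ℤ, Subobject ((single C (ComplexShape.up ℤ) n).obj G))
  have : Fact κ.IsRegular := ⟨hκ'⟩
  have : Nonempty κ.ord.ToType := by simpa using hκ'.ne_zero
  have := WellFoundedLT.toOrderBot κ.ord.ToType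
  have : MorphismProperty.IsSmall.{w} (genCof G) := by
    have : Small.{w} ℤ := Countable.toSmall ℤ
    dsimp only [genCof]; infer_instance
  exact ⟨κ, inferInstance, inferInstance,
    { preservesColimit {A B X Y} i hi f hf := by
        let hf' : (monomorphisms (CochainComplex C ℤ)).TransfiniteCompositionOfShape
            κ.ord.ToType f :=
          { toTransfiniteCompositionOfShape := hf.toTransfiniteCompositionOfShape
            map_mem j hj := by
              have := (hf.attachCells j hj).pushouts_coproducts
              simp only [ofHoms_homFamily] at this
              refine (?_ : _ ≤ monomorphisms _) _ this
              simp only [pushouts_le_iff, coproducts_le_iff]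
              exact genCof_le_mono }
        have (j j' : κ.ord.ToType) (φ : j ⟶ j') : Mono (hf'.F.map φ) := hf'.mem_map φ
        apply IsGrothendieckAbelian.preservesColimit_coyoneda_obj_of_mono (Y := hf'.F) (κ := κ)
        obtain ⟨n⟩ := hi
        exact hκ.of_injective (fun S => ⟨n, S⟩) (fun S T h => by simpa using h) }⟩

theorem exists_kProjective_resolution [IsGrothendieckAbelian.{w} C] [Projective G]
    (hG : IsSeparator G) (X : CochainComplex C ℤ) :
    ∃ (P : CochainComplex C ℤ) (_ : P.IsKProjective) (p : P ⟶ X), QuasiIso p := by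
  have := hasSmallObjectArgument_genCof.{w} (G := G)
  let fac := MorphismProperty.factorizationData (genCof G).rlp.llp (genCof G).rlp (0 : 0 ⟶ X)
  refine ⟨fac.Z, isKProjective_of_genCof (G := G) _ ?_, fac.p, quasiIso_of_genCof_rlp hG _ fac.hp⟩
  rw [← (isZero_zero (CochainComplex C ℤ)).eq_of_src fac.i 0]
  exact fac.hi

end KProj


section Detect

open HomologicalComplex Pretriangulated ZeroObject

universe v₁ u₁

section
variable {D : Type u₁} [Category.{v₁} D] [Preadditive D] [HasZeroObject D] [HasShift D ℤ]
  [∀ n : ℤ, (shiftFunctor D n).Additive] [Pretriangulated D] (P : ObjectProperty D)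

lemma isIso_of_postcomp_bijective (hs : ∀ T, P T → P (T⟦(-1 : ℤ)⟧))
    (h0 : ∀ Z, (∀ T, P T → ∀ g : T ⟶ Z, g = 0) → IsZero Z) {X Y : D} (f : X ⟶ Y)
    (hf : ∀ T, P T → Function.Bijective (fun g : T ⟶ X => g ≫ f)) : IsIso f := by
  obtain ⟨Z, g, h, hT⟩ := distinguished_cocone_triangle f
  have t1 : f ≫ g = 0 := comp_distTriang_mor_zero₁₂ _ hT
  have t2 : h ≫ f⟦(1 : ℤ)⟧' = 0 := comp_distTriang_mor_zero₃₁ _ hT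
  refine (Triangle.isZero₃_iff_isIso₁ _ hT).1 (show IsZero Z from (h0 Z (fun T hPT k => ?_)))
  have h1 : k ≫ h = 0 := by
    let e : T ≅ (T⟦(-1 : ℤ)⟧)⟦(1 : ℤ)⟧ := (shiftEquiv D (1 : ℤ)).counitIso.symm.app T
    obtain ⟨l, hl⟩ := (shiftFunctor D (1 : ℤ)).map_surjective (e.inv ≫ k ≫ h)
    have : l = 0 := by
      apply (hf _ (hs _ hPT)).1
      change l ≫ f = 0 ≫ f
      apply (shiftFunctor D (1 : ℤ)).map_injective
      simp [hl, t2]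
    subst this
    rw [← cancel_epi e.inv, ← hl]
    simp
  obtain ⟨a, ha⟩ : ∃ a : T ⟶ Y, k = a ≫ g := Triangle.coyoneda_exact₃ _ hT k h1
  obtain ⟨b, hb⟩ : ∃ b, b ≫ f = a := (hf _ hPT).2 a
  rw [ha, ← hb, Category.assoc, t1, comp_zero]

lemma isIso_of_precomp_bijective (hs : ∀ T, P T → P (T⟦(-1 : ℤ)⟧))
    (h0 : ∀ Z, (∀ T, P T → ∀ g : Z ⟶ T, g = 0) → IsZero Z) {X Y : D} (f : X ⟶ Y)
    (hf : ∀ T, P T → Function.Bijective (fun g : Y ⟶ T => f ≫ g)) : IsIso f := by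
  obtain ⟨Z, g, h, hT⟩ := distinguished_cocone_triangle f
  have t1 : f ≫ g = 0 := comp_distTriang_mor_zero₁₂ _ hT
  have t2 : h ≫ f⟦(1 : ℤ)⟧' = 0 := comp_distTriang_mor_zero₃₁ _ hT
  refine (Triangle.isZero₃_iff_isIso₁ _ hT).1 (show IsZero Z from (h0 Z (fun T hPT k => ?_)))
  have h1 : g ≫ k = 0 := by
    apply (hf _ hPT).1
    simp [reassoc_of% t1]
  obtain ⟨a, ha⟩ : ∃ a : X⟦(1 : ℤ)⟧ ⟶ T, k = h ≫ a := Triangle.yoneda_exact₃ _ hT k h1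
  let e : T ≅ (T⟦(-1 : ℤ)⟧)⟦(1 : ℤ)⟧ := (shiftEquiv D (1 : ℤ)).counitIso.symm.app T
  obtain ⟨l, hl⟩ := (shiftFunctor D (1 : ℤ)).map_surjective (a ≫ e.hom)
  obtain ⟨b, hb⟩ : ∃ b, f ≫ b = l := (hf _ (hs _ hPT)).2 l
  rw [← cancel_mono e.hom, ha, Category.assoc, ← hl, ← hb, Functor.map_comp, reassoc_of% t2]
  simp

end

variable {C : Type u₁} [Category.{v₁} C] [Abelian C] [HasDerivedCategory.{w} C]

lemma isZero_Q_obj_of_homology (K : CochainComplex C ℤ) (h : ∀ n, IsZero (K.homology n)) :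
    IsZero (Q.obj K) := by
  have hq : IsIso (0 : Q.obj K ⟶ (0 : DerivedCategory C)) := by
    rw [DerivedCategory.isIso_iff]
    intro n
    exact (((h n).of_iso ((homologyFunctorFactors C n).app K)).isIso
      ((DerivedCategory.homologyFunctor C n).map_isZero (isZero_zero _)) _)
  exact (isZero_zero _).of_iso (asIso (0 : Q.obj K ⟶ (0 : DerivedCategory C)))

lemma homologyMap_eq_zero {K L : CochainComplex C ℤ} (f : K ⟶ L) (hf : Q.map f = 0) (n : ℤ) :
    homologyMap f n = 0 := by
  have := (homologyFunctorFactors C n).hom.naturality f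
  dsimp at this
  rw [hf, Functor.map_zero, zero_comp] at this
  exact (cancel_epi ((homologyFunctorFactors C n).hom.app K)).1 (this.symm.trans comp_zero.symm)

lemma single_shift (G : C) (n : ℤ) :
    Nonempty (((singleFunctor C n).obj G)⟦(-1 : ℤ)⟧ ≅ (singleFunctor C (n + 1)).obj G) :=
  ⟨((singleFunctors C).shiftIso (-1) (n+1) n (by lia)).app G⟩

/-- isomorphic to a shift of `G`. -/
def IsSingle (G : C) : ObjectProperty (DerivedCategory C) :=
  fun T => ∃ n : ℤ, Nonempty (T ≅ (singleFunctor C n).obj G)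

lemma IsSingle.shift (G : C) (T) (h : IsSingle G T) : IsSingle G (T⟦(-1 : ℤ)⟧) := by
  obtain ⟨n, ⟨e⟩⟩ := h
  obtain ⟨e'⟩ := single_shift G n
  exact ⟨n + 1, ⟨(shiftFunctor _ (-1 : ℤ)).mapIso e ≪≫ e'⟩⟩

lemma isIso_of_projective {G : C} [Projective G] (hG : IsSeparator G) {X Y : DerivedCategory C}
    (f : X ⟶ Y) (hf : ∀ T, IsSingle G T → Function.Bijective (fun g : T ⟶ X => g ≫ f)) :
    IsIso f := by
  refine isIso_of_postcomp_bijective _ (IsSingle.shift G) (fun Z hZ => ?_) f hf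
  obtain ⟨K, ⟨e⟩⟩ : ∃ K, Nonempty (Q.obj K ≅ Z) := ⟨_, ⟨Q.objObjPreimageIso Z⟩⟩
  refine IsZero.of_iso (isZero_Q_obj_of_homology K (fun n => ?_)) e.symm
  rw [IsZero.iff_id_eq_zero]
  rw [Preadditive.isSeparator_iff] at hG
  apply hG
  intro h
  let z : G ⟶ K.cycles n := Projective.factorThru h (K.homologyπ n)
  have hz : z ≫ K.homologyπ n = h := Projective.factorThru_comp _ _
  let f : (single C (ComplexShape.up ℤ) n).obj G ⟶ K :=
    mkHomFromSingle (z ≫ K.iCycles n) (by simp)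
  have hf : Q.map f = 0 := by
    rw [← cancel_mono e.hom, zero_comp]
    exact hZ _ ⟨n, ⟨Iso.refl _⟩⟩ _
  have hf' : homologyMap f n = 0 := homologyMap_eq_zero f hf n
  have hc : cyclesMap f n = (singleObjCyclesSelfIso (ComplexShape.up ℤ) n G).hom ≫ z := by
    rw [← cancel_mono (K.iCycles n)]
    simp [f, singleObjCyclesSelfIso_hom]
  have := homologyπ_naturality f n
  rw [hf', comp_zero, hc, Category.assoc, hz] at this
  rw [Category.comp_id]
  rw [← cancel_epi (singleObjCyclesSelfIso (ComplexShape.up ℤ) n G).hom, ← this, comp_zero]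

/-- isomorphic to a shift of an injective. -/
def IsSingleInj : ObjectProperty (DerivedCategory C) :=
  fun T => ∃ (I : C) (_ : Injective I), IsSingle I T

lemma isIso_of_injective [EnoughInjectives C] {X Y : DerivedCategory C}
    (f : X ⟶ Y) (hf : ∀ T, IsSingleInj T → Function.Bijective (fun g : Y ⟶ T => f ≫ g)) :
    IsIso f := by
  refine isIso_of_precomp_bijective IsSingleInj
    (fun T ⟨I, hI, hT⟩ => ⟨I, hI, hT.shift⟩) (fun Z hZ => ?_) f hf
  obtain ⟨K, ⟨e⟩⟩ : ∃ K, Nonempty (Q.obj K ≅ Z) := ⟨_, ⟨Q.objObjPreimageIso Z⟩⟩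
  refine IsZero.of_iso (isZero_Q_obj_of_homology K (fun n => ?_)) e.symm
  let I := Injective.under (K.homology n)
  let h : K.homology n ⟶ I := Injective.ι _
  let z : K.opcycles n ⟶ I := Injective.factorThru h (K.homologyι n)
  have hz : K.homologyι n ≫ z = h := Injective.comp_factorThru _ _
  let f : K ⟶ (single C (ComplexShape.up ℤ) n).obj I :=
    mkHomToSingle (K.pOpcycles n ≫ z) (by simp)
  have hf : Q.map f = 0 := by
    rw [← cancel_epi e.inv, comp_zero]
    exact hZ _ ⟨I, inferInstance, n, ⟨Iso.refl _⟩⟩ _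
  have hf' : homologyMap f n = 0 := homologyMap_eq_zero f hf n
  have hc : opcyclesMap f n = z ≫ (singleObjOpcyclesSelfIso (ComplexShape.up ℤ) n I).hom := by
    rw [← cancel_epi (K.pOpcycles n)]
    simp [f, singleObjOpcyclesSelfIso_hom]
  have := homologyι_naturality f n
  rw [hf', zero_comp, hc, ← Category.assoc, hz] at this
  have h0 : h = 0 := by
    rw [← cancel_mono (singleObjOpcyclesSelfIso (ComplexShape.up ℤ) n I).hom, ← this, zero_comp]
  rw [IsZero.iff_id_eq_zero, ← cancel_mono h]
  simp [h0]

end Detect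


section DerivedAdj

open HomologicalComplex

universe v₁ u₁ v₂ u₂

section
variable {C : Type u₁} [Category.{v₁} C] [Abelian C] [HasDerivedCategory.{w} C]

lemma kInj_surj (K L : CochainComplex C ℤ) [L.IsKInjective] (f : Q.obj K ⟶ Q.obj L) :
    ∃ g : K ⟶ L, Q.map g = f := by
  obtain ⟨g, hg⟩ := (CochainComplex.IsKInjective.Qh_map_bijective
    ((HomotopyCategory.quotient _ _).obj K) L).2
    ((quotientCompQhIso C).hom.app K ≫ f ≫ (quotientCompQhIso C).inv.app L)
  obtain ⟨g, rfl⟩ := (HomotopyCategory.quotient _ _).map_surjective g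
  refine ⟨g, ?_⟩
  have := quotientCompQhIso_hom_naturality g
  rw [hg] at this
  rw [← cancel_epi ((quotientCompQhIso C).hom.app K), ← this]
  simp

lemma kProj_surj (K L : CochainComplex C ℤ) [K.IsKProjective] (f : Q.obj K ⟶ Q.obj L) :
    ∃ g : K ⟶ L, Q.map g = f := by
  obtain ⟨g, hg⟩ := (CochainComplex.IsKProjective.Qh_map_bijective
    K ((HomotopyCategory.quotient _ _).obj L)).2
    ((quotientCompQhIso C).hom.app K ≫ f ≫ (quotientCompQhIso C).inv.app L)
  obtain ⟨g, rfl⟩ := (HomotopyCategory.quotient _ _).map_surjective g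
  refine ⟨g, ?_⟩
  have := quotientCompQhIso_hom_naturality g
  rw [hg] at this
  rw [← cancel_epi ((quotientCompQhIso C).hom.app K), ← this]
  simp

lemma kInj_inj (K L : CochainComplex C ℤ) [L.IsKInjective] (f : K ⟶ L) (hf : Q.map f = 0) :
    Nonempty (Homotopy f 0) := by
  refine ⟨HomotopyCategory.homotopyOfEq _ _ ?_⟩
  apply (CochainComplex.IsKInjective.Qh_map_bijective
    ((HomotopyCategory.quotient _ _).obj K) L).1
  have := quotientCompQhIso_hom_naturality f
  rw [hf, comp_zero] at this
  rw [← cancel_mono ((quotientCompQhIso C).hom.app L)]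
  rw [Functor.map_zero, Functor.map_zero, zero_comp]
  exact this

lemma kProj_inj (K L : CochainComplex C ℤ) [K.IsKProjective] (f : K ⟶ L) (hf : Q.map f = 0) :
    Nonempty (Homotopy f 0) := by
  refine ⟨HomotopyCategory.homotopyOfEq _ _ ?_⟩
  apply (CochainComplex.IsKProjective.Qh_map_bijective
    K ((HomotopyCategory.quotient _ _).obj L)).1
  have := quotientCompQhIso_hom_naturality f
  rw [hf, comp_zero] at this
  rw [← cancel_mono ((quotientCompQhIso C).hom.app L)]
  rw [Functor.map_zero, Functor.map_zero, zero_comp]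
  exact this

lemma Q_map_eq_zero {K L : CochainComplex C ℤ} {f : K ⟶ L} (h : Homotopy f 0) :
    Q.map f = 0 := by
  rw [Q_map_eq_of_homotopy _ h, Functor.map_zero]

end

section
variable {A : Type u₁} [Category.{v₁} A] [Abelian A]
  {B : Type u₂} [Category.{v₂} B] [Abelian B]

section
variable {F : A ⥤ B} {G : B ⥤ A} [F.Additive] [G.Additive] (adj : F ⊣ G)

/-- chain level unit -/
def cUnit (K : CochainComplex A ℤ) : K ⟶
    (G.mapHomologicalComplex _).obj ((F.mapHomologicalComplex _).obj K) where
  f n := adj.unit.app (K.X n)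
  comm' i j _ := (adj.unit.naturality (K.d i j)).symm

/-- chain level counit -/
def cCounit (K : CochainComplex B ℤ) :
    (F.mapHomologicalComplex _).obj ((G.mapHomologicalComplex _).obj K) ⟶ K where
  f n := adj.counit.app (K.X n)
  comm' i j _ := (adj.counit.naturality (K.d i j)).symm

/-- chain level adjunction -/
def toR {K : CochainComplex A ℤ} {L : CochainComplex B ℤ}
    (f : (F.mapHomologicalComplex _).obj K ⟶ L) : K ⟶ (G.mapHomologicalComplex _).obj L :=
  cUnit adj K ≫ (G.mapHomologicalComplex _).map f

/-- chain level adjunction -/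
def toL {K : CochainComplex A ℤ} {L : CochainComplex B ℤ}
    (f : K ⟶ (G.mapHomologicalComplex _).obj L) : (F.mapHomologicalComplex _).obj K ⟶ L :=
  (F.mapHomologicalComplex _).map f ≫ cCounit adj L

lemma toL_toR {K : CochainComplex A ℤ} {L : CochainComplex B ℤ}
    (f : (F.mapHomologicalComplex _).obj K ⟶ L) : toL adj (toR adj f) = f := by
  ext n
  have h (g : F.obj (K.X n) ⟶ L.X n) :
      F.map (adj.unit.app (K.X n) ≫ G.map g) ≫ adj.counit.app (L.X n) = g := by simp
  exact h (f.f n)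

lemma toR_toL {K : CochainComplex A ℤ} {L : CochainComplex B ℤ}
    (f : K ⟶ (G.mapHomologicalComplex _).obj L) : toR adj (toL adj f) = f := by
  ext n
  have h (g : K.X n ⟶ G.obj (L.X n)) :
      adj.unit.app (K.X n) ≫ G.map (F.map g ≫ adj.counit.app (L.X n)) = g := by simp
  exact h (f.f n)

lemma homotopy_toR {K : CochainComplex A ℤ} {L : CochainComplex B ℤ}
    (f : (F.mapHomologicalComplex _).obj K ⟶ L) (h : Nonempty (Homotopy f 0)) :
    Nonempty (Homotopy (toR adj f) 0) := by
  obtain ⟨h⟩ := h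
  exact ⟨((G.mapHomotopy h).compLeft (cUnit adj K)).trans (Homotopy.ofEq (by simp))⟩

lemma homotopy_toL {K : CochainComplex A ℤ} {L : CochainComplex B ℤ}
    (f : K ⟶ (G.mapHomologicalComplex _).obj L) (h : Nonempty (Homotopy f 0)) :
    Nonempty (Homotopy (toL adj f) 0) := by
  obtain ⟨h⟩ := h
  exact ⟨((F.mapHomotopy h).compRight (cCounit adj L)).trans (Homotopy.ofEq (by simp))⟩

end

lemma acyclic_map (F : A ⥤ B) [F.Additive] [PreservesFiniteLimits F] [PreservesFiniteColimits F]
    (K : CochainComplex A ℤ) (hK : K.Acyclic) :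
    ((F.mapHomologicalComplex (ComplexShape.up ℤ)).obj K).Acyclic := fun n =>
  ShortComplex.Exact.map (hK n) F

variable [HasDerivedCategory.{w} A] [HasDerivedCategory.{w} B]
  (F : A ⥤ B) [F.Additive] [PreservesFiniteLimits F] [PreservesFiniteColimits F]

lemma exists_right {G : B ⥤ A} [G.Additive] (adj : F ⊣ G) (J : CochainComplex B ℤ)
    [J.IsKInjective] :
    ∃ (Z : DerivedCategory A) (ε : F.mapDerivedCategory.obj Z ⟶ Q.obj J),
      ∀ X, Function.Bijective (fun f : X ⟶ Z => F.mapDerivedCategory.map f ≫ ε) := by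
  let GJ : CochainComplex A ℤ := (G.mapHomologicalComplex (ComplexShape.up ℤ)).obj J
  have : GJ.IsKInjective := ⟨fun {K} f hK => by
    obtain ⟨h⟩ := homotopy_toR adj _ (CochainComplex.IsKInjective.nonempty_homotopy_zero
      (toL adj f) (acyclic_map F K hK))
    exact ⟨(Homotopy.ofEq (toR_toL adj f).symm).trans h⟩⟩
  refine ⟨Q.obj GJ, F.mapDerivedCategoryFactors.hom.app GJ ≫ Q.map (cCounit adj J), fun X => ?_⟩
  obtain ⟨K, ⟨e⟩⟩ : ∃ K, Nonempty (Q.obj K ≅ X) := ⟨_, ⟨Q.objObjPreimageIso X⟩⟩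
  have key (f₀ : K ⟶ GJ) : F.mapDerivedCategory.map (Q.map f₀) ≫
      F.mapDerivedCategoryFactors.hom.app GJ ≫ Q.map (cCounit adj J) =
      F.mapDerivedCategoryFactors.hom.app K ≫ Q.map (toL adj f₀) := by
    rw [F.mapDerivedCategoryFactors_hom_naturality_assoc, ← Q.map_comp]
    rfl
  constructor
  · intro f g hfg
    rw [← sub_eq_zero]
    have h : F.mapDerivedCategory.map (f - g) ≫ F.mapDerivedCategoryFactors.hom.app GJ ≫
        Q.map (cCounit adj J) = 0 := by
      rw [Functor.map_sub, Preadditive.sub_comp, sub_eq_zero]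
      exact hfg
    generalize f - g = a at *
    obtain ⟨a₀, ha₀⟩ := kInj_surj K GJ (e.hom ≫ a)
    have h' : Q.map (toL adj a₀) = 0 := by
      rw [← cancel_epi (F.mapDerivedCategoryFactors.hom.app K), ← key, ha₀]
      simp [h]
    obtain ⟨h2⟩ := homotopy_toR adj _ (kInj_inj _ _ _ h')
    rw [← cancel_epi e.hom, ← ha₀, comp_zero, ← toR_toL adj a₀]
    exact Q_map_eq_zero h2
  · intro g
    obtain ⟨g₀, hg₀⟩ := kInj_surj _ J
      (F.mapDerivedCategoryFactors.inv.app K ≫ F.mapDerivedCategory.map e.hom ≫ g)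
    refine ⟨e.inv ≫ Q.map (toR adj g₀), ?_⟩
    dsimp only
    rw [Functor.map_comp, Category.assoc, key, toL_toR, hg₀]
    simp [← Functor.map_comp_assoc]

lemma exists_left {L : B ⥤ A} [L.Additive] (adj : L ⊣ F) (P : CochainComplex B ℤ)
    [P.IsKProjective] :
    ∃ (Z : DerivedCategory A) (η : Q.obj P ⟶ F.mapDerivedCategory.obj Z),
      ∀ Y, Function.Bijective (fun f : Z ⟶ Y => η ≫ F.mapDerivedCategory.map f) := by
  let LP : CochainComplex A ℤ := (L.mapHomologicalComplex (ComplexShape.up ℤ)).obj P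
  have : LP.IsKProjective := ⟨fun {K} f hK => by
    obtain ⟨h⟩ := homotopy_toL adj _ (CochainComplex.IsKProjective.nonempty_homotopy_zero
      (toR adj f) (acyclic_map F K hK))
    exact ⟨(Homotopy.ofEq (toL_toR adj f).symm).trans h⟩⟩
  refine ⟨Q.obj LP, Q.map (cUnit adj P) ≫ F.mapDerivedCategoryFactors.inv.app LP, fun X => ?_⟩
  obtain ⟨K, ⟨e⟩⟩ : ∃ K, Nonempty (Q.obj K ≅ X) := ⟨_, ⟨Q.objObjPreimageIso X⟩⟩
  have key (f₀ : LP ⟶ K) : (Q.map (cUnit adj P) ≫ F.mapDerivedCategoryFactors.inv.app LP) ≫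
      F.mapDerivedCategory.map (Q.map f₀) =
      Q.map (toR adj f₀) ≫ F.mapDerivedCategoryFactors.inv.app K := by
    have := F.mapDerivedCategoryFactors.inv.naturality f₀
    dsimp at this
    rw [Category.assoc, ← this, ← Category.assoc, ← Q.map_comp]
    rfl
  constructor
  · intro f g hfg
    rw [← sub_eq_zero]
    have h : (Q.map (cUnit adj P) ≫ F.mapDerivedCategoryFactors.inv.app LP) ≫
        F.mapDerivedCategory.map (f - g) = 0 := by
      rw [Functor.map_sub, Preadditive.comp_sub, sub_eq_zero]
      exact hfg
    generalize f - g = a at *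
    obtain ⟨a₀, ha₀⟩ := kProj_surj LP K (a ≫ e.inv)
    have h' : Q.map (toR adj a₀) = 0 := by
      rw [← cancel_mono (F.mapDerivedCategoryFactors.inv.app K), ← key, ha₀, Functor.map_comp,
        ← Category.assoc, h, zero_comp, zero_comp]
    obtain ⟨h2⟩ := homotopy_toL adj _ (kProj_inj _ _ _ h')
    rw [← cancel_mono e.inv, ← ha₀, zero_comp, ← toL_toR adj a₀]
    exact Q_map_eq_zero h2
  · intro g
    obtain ⟨g₀, hg₀⟩ := kProj_surj P _
      (g ≫ F.mapDerivedCategory.map e.inv ≫ F.mapDerivedCategoryFactors.hom.app K)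
    refine ⟨Q.map (toL adj g₀) ≫ e.hom, ?_⟩
    dsimp only
    rw [Functor.map_comp, ← Category.assoc, key, toR_toL, hg₀]
    simp [← Functor.map_comp]

end

end DerivedAdj


section Core

section
universe v₃ u₃
variable {D : Type u₃} [Category.{v₃} D]

lemma postcomp_bij (T : D) {X Y : D} (f : X ⟶ Y) [IsIso f] :
    Function.Bijective (fun g : T ⟶ X => g ≫ f) :=
  ⟨fun _ _ h => (cancel_mono f).1 h, fun g => ⟨g ≫ inv f, by simp⟩⟩

lemma precomp_bij (T : D) {X Y : D} (f : X ⟶ Y) [IsIso f] :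
    Function.Bijective (fun g : Y ⟶ T => f ≫ g) :=
  ⟨fun _ _ h => (cancel_epi f).1 h, fun g => ⟨inv f ≫ g, by simp⟩⟩

end

open HomologicalComplex

universe v₁ u₁ v₂ u₂ w'

variable {A : Type u₁} [Category.{v₁} A] [Abelian A] [HasDerivedCategory.{w} A]
  {B : Type u₂} [Category.{v₂} B] [Abelian B] [HasDerivedCategory.{w} B]

section

variable (U : DerivedCategory A ⥤ DerivedCategory B)

/-- The functor `U` is bijective on morphisms from `X` to `Y`. -/
def Bij (X Y : DerivedCategory A) : Prop :=
  Function.Bijective (U.map : (X ⟶ Y) → (U.obj X ⟶ U.obj Y))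

variable {U}

lemma Bij.of_iso {X Y X' Y' : DerivedCategory A} (h : Bij U X Y) (e : X ≅ X') (e' : Y ≅ Y') :
    Bij U X' Y' := by
  have : (U.map : (X' ⟶ Y') → _) = (Iso.homCongr (U.mapIso e) (U.mapIso e')) ∘ U.map ∘
      (Iso.homCongr e e').symm := by
    ext f
    simp [Iso.homCongr, ← Functor.map_comp]
  rw [Bij, this]
  exact (Equiv.bijective _).comp (h.comp (Equiv.bijective _))

lemma Bij.shift [U.CommShift ℤ] {X Y : DerivedCategory A} (h : Bij U X Y) (m : ℤ) :
    Bij U (X⟦m⟧) (Y⟦m⟧) := by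
  have hs : Function.Bijective ((shiftFunctor (DerivedCategory A) m).map : (X ⟶ Y) → _) :=
    ⟨Functor.map_injective _, Functor.map_surjective _⟩
  have hs' : Function.Bijective ((shiftFunctor (DerivedCategory B) m).map :
      (U.obj X ⟶ U.obj Y) → _) :=
    ⟨Functor.map_injective _, Functor.map_surjective _⟩
  have key : (U.map : (X⟦m⟧ ⟶ Y⟦m⟧) → _) ∘ (shiftFunctor (DerivedCategory A) m).map =
      (Iso.homCongr ((U.commShiftIso m).symm.app X) ((U.commShiftIso m).symm.app Y)) ∘
      (shiftFunctor (DerivedCategory B) m).map ∘ U.map := by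
    ext f
    simp [Iso.homCongr]
  have := (Equiv.bijective (Iso.homCongr ((U.commShiftIso m).symm.app X)
    ((U.commShiftIso m).symm.app Y))).comp (hs'.comp h)
  rw [← key] at this
  exact (Function.Bijective.of_comp_iff _ hs).1 this

lemma single_iso_shift {C : Type u₁} [Category.{v₁} C] [Abelian C] [HasDerivedCategory.{w} C]
    (G : C) (n m : ℤ) (h : m + n = 0) :
    Nonempty (((singleFunctor C 0).obj G)⟦m⟧ ≅ (singleFunctor C n).obj G) :=
  ⟨((singleFunctors C).shiftIso m n 0 h).app G⟩

/-- shifting by `m` and then by `n` with `m + n = 0`. -/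
lemma shift_iso {C : Type u₁} [Category.{v₁} C] [Abelian C] [HasDerivedCategory.{w} C]
    (X : DerivedCategory C) (m n : ℤ) (h : m + n = 0) : Nonempty (X⟦m⟧⟦n⟧ ≅ X) :=
  ⟨(shiftFunctorCompIsoId _ m n h).app X⟩

end

variable (F : A ⥤ B) [F.Additive] [PreservesFiniteLimits F] [PreservesFiniteColimits F]

lemma bij_injective {G : B ⥤ A} [G.Additive] (adj : F ⊣ G) [EnoughInjectives B]
    {P : A} [Projective P] (hP : IsSeparator P) (I : A)
    (h : ∀ T, IsSingle P T → Bij F.mapDerivedCategory T ((singleFunctor A 0).obj I))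
    (X : DerivedCategory A) : Bij F.mapDerivedCategory X ((singleFunctor A 0).obj I) := by
  let U := F.mapDerivedCategory
  let R := injectiveResolution (F.obj I)
  have : R.cochainComplex.IsKInjective := CochainComplex.isKInjective_of_injective _ 0
  obtain ⟨Z, ε, hε⟩ := exists_right F adj R.cochainComplex
  have : IsIso (Q.map R.ι') := (isIso_Q_map_iff_quasiIso _ _).2 inferInstance
  let e₀ : (singleFunctor B 0).obj (F.obj I) ≅ Q.obj R.cochainComplex :=
    @asIso _ _ _ _ (Q.map R.ι') this
  let e : U.obj ((singleFunctor A 0).obj I) ≅ Q.obj R.cochainComplex :=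
    (F.mapDerivedCategorySingleFunctor 0).app I ≪≫ e₀
  obtain ⟨u, hu⟩ : ∃ u, U.map u ≫ ε = e.hom := (hε _).2 e.hom
  have he (X : DerivedCategory A) : Function.Bijective
      (fun g : U.obj X ⟶ U.obj ((singleFunctor A 0).obj I) => g ≫ e.hom) :=
    postcomp_bij _ _
  have key (X : DerivedCategory A) : (fun g => g ≫ e.hom) ∘
      (U.map : (X ⟶ (singleFunctor A 0).obj I) → _) =
      (fun f : X ⟶ Z => U.map f ≫ ε) ∘ (fun g => g ≫ u) := by
    ext g
    simp [hu]
  have hu' : IsIso u := by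
    apply isIso_of_projective hP
    intro T hT
    have := (he T).comp (h T hT)
    rw [key] at this
    exact (Function.Bijective.of_comp_iff' (hε T) _).1 this
  have h2 : Function.Bijective (fun g : X ⟶ (singleFunctor A 0).obj I => g ≫ u) :=
    postcomp_bij _ _
  have := (hε X).comp h2
  rw [← key] at this
  exact (Function.Bijective.of_comp_iff' (he X) _).1 this

theorem bij_of_single {G : B ⥤ A} [G.Additive] (adj : F ⊣ G) {L : B ⥤ A} [L.Additive]
    (adj' : L ⊣ F) [EnoughInjectives A] [EnoughInjectives B]
    [IsGrothendieckAbelian.{w'} B] {P' : B} [Projective P'] (hP' : IsSeparator P')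
    {P : A} [Projective P] (hP : IsSeparator P)
    (h : ∀ T I, IsSingle P T → Bij F.mapDerivedCategory T ((singleFunctor A 0).obj I))
    (X Y : DerivedCategory A) : Bij F.mapDerivedCategory X Y := by
  have h1 (X T : DerivedCategory A) (hT : IsSingleInj T) : Bij F.mapDerivedCategory X T := by
    obtain ⟨I, _, n, ⟨e⟩⟩ := hT
    obtain ⟨e'⟩ := single_iso_shift I n (-n) (by lia)
    obtain ⟨e₃⟩ := shift_iso X n (-n) (by lia)
    exact ((bij_injective F adj hP I (fun T hT => h T I hT) (X⟦n⟧)).shift (-n)).of_iso e₃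
      (e' ≪≫ e.symm)
  let U := F.mapDerivedCategory
  obtain ⟨K, ⟨eK⟩⟩ : ∃ K, Nonempty (Q.obj K ≅ U.obj X) := ⟨_, ⟨Q.objObjPreimageIso _⟩⟩
  obtain ⟨Pr, _, p, _⟩ := exists_kProjective_resolution.{w'} hP' K
  obtain ⟨Z, η, hη⟩ := exists_left F adj' Pr
  let e : Q.obj Pr ≅ U.obj X := asIso (Q.map p) ≪≫ eK
  obtain ⟨u, hu⟩ : ∃ u, η ≫ U.map u = e.hom := (hη _).2 e.hom
  have he (Y : DerivedCategory A) : Function.Bijective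
      (fun g : U.obj X ⟶ U.obj Y => e.hom ≫ g) :=
    precomp_bij _ _
  have key (Y : DerivedCategory A) : (fun g => e.hom ≫ g) ∘ (U.map : (X ⟶ Y) → _) =
      (fun f : Z ⟶ Y => η ≫ U.map f) ∘ (fun g => u ≫ g) := by
    ext g
    simp [← hu]
  have hu' : IsIso u := by
    apply isIso_of_injective
    intro T hT
    have := (he T).comp (h1 X T hT)
    rw [key] at this
    exact (Function.Bijective.of_comp_iff' (hη T) _).1 this
  have h2 : Function.Bijective (fun g : X ⟶ Y => u ≫ g) :=
    precomp_bij _ _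
  have := (hη Y).comp h2
  rw [← key] at this
  exact (Function.Bijective.of_comp_iff' (he Y) _).1 this

end Core

section Modules

lemma extMap_bijective_iff_bij (M M' : ModuleCat.{u} S) (n : ℕ) :
    Function.Bijective (fun e : Abelian.Ext.{w} M M' n => extMap φ e) ↔
    Bij (Dphi φ) ((singleFunctor (ModuleCat.{u} S) 0).obj M)
      (((singleFunctor (ModuleCat.{u} S) 0).obj M')⟦(n : ℤ)⟧) := by
  let e₁ := singleObjIso φ M
  let e₂ : (Dphi φ).obj (((singleFunctor (ModuleCat.{u} S) 0).obj M')⟦(n : ℤ)⟧) ≅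
      ((singleFunctor (ModuleCat.{u} R) 0).obj
        ((ModuleCat.restrictScalars φ).obj M'))⟦(n : ℤ)⟧ :=
    ((Dphi φ).commShiftIso (n : ℤ)).app _ ≪≫
      (shiftFunctor (DerivedCategory (ModuleCat.{u} R)) (n : ℤ)).mapIso (singleObjIso φ M')
  have key : (fun e : Abelian.Ext.{w} M M' n => extMap φ e) =
      (Abelian.Ext.homEquiv : Abelian.Ext.{w} ((ModuleCat.restrictScalars φ).obj M)
        ((ModuleCat.restrictScalars φ).obj M') n ≃ _).symm ∘ (Iso.homCongr e₁ e₂) ∘ (Dphi φ).map ∘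
        (Abelian.Ext.homEquiv : Abelian.Ext.{w} M M' n ≃ _) := by
    ext e : 1
    rfl
  rw [key]
  rw [Function.Bijective.of_comp_iff' (Equiv.bijective _),
    Function.Bijective.of_comp_iff' (Equiv.bijective _),
    Function.Bijective.of_comp_iff _ (Equiv.bijective _)]
  rfl

lemma single_hom_eq_zero {C : Type*} [Category* C] [Abelian C] [HasDerivedCategory.{w} C]
    (M M' : C) (n : ℤ) (hn : n < 0)
    (f : (singleFunctor C 0).obj M ⟶ ((singleFunctor C 0).obj M')⟦n⟧) : f = 0 := by
  obtain ⟨e⟩ := single_iso_shift M' (-n) n (by lia)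
  rw [← cancel_mono e.hom, zero_comp]
  exact TStructure.t.zero_of_isLE_of_isGE _ 0 (-n) (by lia) inferInstance inferInstance

lemma bij_neg (M M' : ModuleCat.{u} S) (n : ℤ) (hn : n < 0) :
    Bij (Dphi φ) ((singleFunctor (ModuleCat.{u} S) 0).obj M)
      (((singleFunctor (ModuleCat.{u} S) 0).obj M')⟦n⟧) := by
  let e₁ := singleObjIso φ M
  let e₂ : (Dphi φ).obj (((singleFunctor (ModuleCat.{u} S) 0).obj M')⟦n⟧) ≅
      ((singleFunctor (ModuleCat.{u} R) 0).obj
        ((ModuleCat.restrictScalars φ).obj M'))⟦n⟧ :=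
    ((Dphi φ).commShiftIso n).app _ ≪≫
      (shiftFunctor (DerivedCategory (ModuleCat.{u} R)) n).mapIso (singleObjIso φ M')
  refine ⟨fun f g _ => ?_, fun g => ⟨0, ?_⟩⟩
  · rw [single_hom_eq_zero _ _ n hn f, single_hom_eq_zero _ _ n hn g]
  · rw [Functor.map_zero, ← cancel_mono e₂.hom, ← cancel_epi e₁.inv, zero_comp, comp_zero]
    exact (single_hom_eq_zero _ _ n hn _).symm

lemma restrictScalars_preservesLimits : PreservesLimits (ModuleCat.restrictScalars.{u} φ) := by
  have : PreservesLimits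
      (ModuleCat.restrictScalars.{u} φ ⋙ forget₂ (ModuleCat.{u} R) AddCommGrpCat) :=
    preservesLimits_of_natIso (restrictScalarsCompForget₂Iso φ).symm
  have : ReflectsLimits (forget₂ (ModuleCat.{u} R) AddCommGrpCat) :=
    reflectsLimits_of_reflectsIsomorphisms
  exact preservesLimits_of_reflects_of_preserves _
    (forget₂ (ModuleCat.{u} R) AddCommGrpCat)

lemma restrictScalars_isRightAdjoint : (ModuleCat.restrictScalars.{u} φ).IsRightAdjoint := by
  have := restrictScalars_preservesLimits φ
  exact isRightAdjoint_of_preservesLimits_of_isCoseparating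
    (isCoseparator_coseparator (ModuleCat.{u} S)) _

lemma exists_projective_separator (T : Type u) [Ring T] :
    ∃ (P : ModuleCat.{u} T) (_ : Projective P), IsSeparator P := by
  refine ⟨_, ?_, ModuleCat.isSeparator.{u} T⟩
  rw [← IsProjective.iff_projective]
  exact Module.Projective.of_equiv (Shrink.linearEquiv T T).symm

end Modules

/-- For a ring homomorphism `φ : R →+* S`, the natural maps
`Ext^i_S(M,M') → Ext^i_R(M,M')` induced by restriction of scalars are isomorphisms for all
left `S`-modules `M, M'` and all `i ≥ 0` if and only if the functor `D(φ) : D(S) → D(R)`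
induced by restriction of scalars is fully faithful. -/
theorem extMap_bijective_iff_derived_fully_faithful :
    (∀ (M M' : ModuleCat.{u} S) (i : ℕ),
      Function.Bijective (fun e : Abelian.Ext.{w} M M' i => extMap φ e)) ↔
    ((Dphi φ).Full ∧ (Dphi φ).Faithful) := by
  constructor
  · intro h
    obtain ⟨P, _, hP⟩ := exists_projective_separator S
    obtain ⟨P', _, hP'⟩ := exists_projective_separator R
    have := restrictScalars_isRightAdjoint φ
    let adj := ModuleCat.restrictCoextendScalarsAdj.{u} φ
    let adj' := Adjunction.ofIsRightAdjoint (ModuleCat.restrictScalars.{u} φ)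
    have := adj.right_adjoint_additive
    have := adj'.left_adjoint_additive
    have hb (X Y) : Bij (Dphi φ) X Y := by
      refine bij_of_single.{w, u} (ModuleCat.restrictScalars.{u} φ) adj adj' hP' hP ?_ X Y
      rintro T I ⟨n, ⟨e⟩⟩
      obtain ⟨e'⟩ := single_iso_shift P n (-n) (by lia)
      obtain ⟨e₃⟩ := shift_iso ((singleFunctor (ModuleCat.{u} S) 0).obj I) n (-n) (by lia)
      refine Bij.of_iso (Bij.shift ?_ (-n)) (e' ≪≫ e.symm) e₃
      by_cases hn : n < 0
      · exact bij_neg φ P I n hn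
      · obtain ⟨k, rfl⟩ := Int.eq_ofNat_of_zero_le (not_lt.1 hn)
        exact (extMap_bijective_iff_bij φ P I k).1 (h P I k)
    exact ⟨⟨fun {X Y} => (hb X Y).2⟩, ⟨fun {X Y} _ _ hfg => (hb X Y).1 hfg⟩⟩
  · rintro ⟨_, _⟩ M M' i
    rw [extMap_bijective_iff_bij]
    exact ⟨Functor.map_injective _, Functor.map_surjective _⟩

end RingHomEpi
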